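/- Let A be a finite totally ordered alphabet with |A| = n. Then the 2-sylvester monoid Sylv(A,2) contains exactly Σ_{k=0}^{n} binomial(n,k) · S(k) idempotent elements, where S denotes the shifted Schröder numbers. -/

import Mathlib

/-- The defining relations of the 2-sylvester monoid: `a·c·W·b = c·a·W·b`
for all letters `a ≤ b < c` and all words `W`, together with `a² = a`
for every letter `a`. -/
def sylv2Rel {A : Type*} [LinearOrder A] (U V : FreeMonoid A) : Prop :=
  (∃ (a b c : A) (W : FreeMonoid A), a ≤ b ∧ b < c ∧
    U = FreeMonoid.of a * FreeMonoid.of c * W * FreeMonoid.of b ∧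
    V = FreeMonoid.of c * FreeMonoid.of a * W * FreeMonoid.of b) ∨
  (∃ a : A, U = FreeMonoid.of a * FreeMonoid.of a ∧ V = FreeMonoid.of a)

/-- The congruence on the free monoid defining the 2-sylvester monoid `Sylv(A, 2)`. -/
def sylv2Con (A : Type*) [LinearOrder A] : Con (FreeMonoid A) :=
  conGen sylv2Rel

/-- The large Schröder numbers: `D(0) = 1` and
`D(n+1) = D(n) + Σ_{k=0}^{n} D(k)·D(n−k)` (so `D = 1, 2, 6, 22, 90, …`). -/
def schroeder : ℕ → ℕ
  | 0 => 1
  | n + 1 => schroeder n +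
      ∑ k ∈ (Finset.range (n + 1)).attach, schroeder k.1 * schroeder (n - k.1)
  decreasing_by
  · exact Nat.lt_succ_self n
  · exact Nat.lt_succ_of_le (Nat.le_of_lt_succ (Finset.mem_range.mp k.2))
  · exact Nat.lt_succ_of_le (Nat.sub_le n k.1)

/-- The shifted Schröder numbers: `S(0) = 1` and `S(k) = D(k−1)` for `k ≥ 1`
(so `S = 1, 1, 2, 6, 22, 90, …`). -/
def shiftedSchroeder : ℕ → ℕ
  | 0 => 1
  | k + 1 => schroeder k

section Profile

variable {A : Type*} [LinearOrder A]

/-- The largest letter of `v` that is smaller than `a`, or `⊥` if there is none. -/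
def maxBelow (a : A) : List A → WithBot A
  | [] => ⊥
  | x :: v => if x < a then max (x : WithBot A) (maxBelow a v) else maxBelow a v

/-- The set of values `maxBelow a v`, where `v` ranges over the suffixes of `w` following
an occurrence of `a`. -/
def profile (a : A) : List A → Finset (WithBot A)
  | [] => ∅
  | x :: v => if x = a then insert (maxBelow a v) (profile a v) else profile a v

theorem maxBelow_le_iff {a : A} {v : List A} {p : WithBot A} :
    maxBelow a v ≤ p ↔ ∀ x ∈ v, x < a → (x : WithBot A) ≤ p := by
  induction v with
  | nil => simp [maxBelow]
  | cons x v ih =>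
    by_cases h : x < a <;> simp [maxBelow, h, ih]

theorem le_maxBelow {a x : A} {v : List A} (hx : x ∈ v) (h : x < a) :
    (x : WithBot A) ≤ maxBelow a v :=
  maxBelow_le_iff.1 le_rfl x hx h

theorem mem_of_maxBelow_eq {a b : A} {v : List A} (h : maxBelow a v = b) : b ∈ v ∧ b < a := by
  induction v with
  | nil => simp [maxBelow] at h
  | cons x v ih =>
    by_cases hx : x < a
    · simp only [maxBelow, hx, if_true] at h
      rcases max_choice (x : WithBot A) (maxBelow a v) with h' | h' <;> rw [h'] at h
      · have := WithBot.coe_injective h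
        subst this
        simp [hx]
      · exact ⟨List.mem_cons_of_mem _ (ih h).1, (ih h).2⟩
    · simp only [maxBelow, hx, if_false] at h
      exact ⟨List.mem_cons_of_mem _ (ih h).1, (ih h).2⟩

theorem maxBelow_append (a : A) (u v : List A) :
    maxBelow a (u ++ v) = max (maxBelow a u) (maxBelow a v) := by
  induction u with
  | nil => simp [maxBelow]
  | cons x u ih =>
    by_cases h : x < a <;> simp [maxBelow, h, ih, max_assoc]

theorem maxBelow_le_append (a : A) (u v : List A) : maxBelow a v ≤ maxBelow a (u ++ v) := by
  simp [maxBelow_append]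

theorem maxBelow_congr {a : A} {u v : List A} (h : ∀ x, x ∈ u ↔ x ∈ v) :
    maxBelow a u = maxBelow a v :=
  le_antisymm (maxBelow_le_iff.2 fun x hx => le_maxBelow ((h x).1 hx))
    (maxBelow_le_iff.2 fun x hx => le_maxBelow ((h x).2 hx))

theorem mem_profile {a : A} {w : List A} {p : WithBot A} :
    p ∈ profile a w ↔ ∃ u v, w = u ++ a :: v ∧ p = maxBelow a v := by
  induction w with
  | nil => simp [profile]
  | cons x w ih =>
    constructor
    · intro h
      by_cases hx : x = a
      · subst hx
        simp only [profile, if_true, Finset.mem_insert] at h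
        rcases h with h | h
        · exact ⟨[], w, rfl, h⟩
        · obtain ⟨u, v, rfl, hp⟩ := ih.1 h
          exact ⟨x :: u, v, rfl, hp⟩
      · simp only [profile, hx, if_false] at h
        obtain ⟨u, v, rfl, hp⟩ := ih.1 h
        exact ⟨x :: u, v, rfl, hp⟩
    · rintro ⟨u, v, h, rfl⟩
      cases u with
      | nil =>
        simp only [List.nil_append, List.cons.injEq] at h
        obtain ⟨rfl, rfl⟩ := h
        simp [profile]
      | cons y u =>
        simp only [List.cons_append, List.cons.injEq] at h
        have := ih.2 ⟨u, v, h.2, rfl⟩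
        unfold profile
        split_ifs <;> simp [this]

theorem profile_nonempty {a : A} {w : List A} : (profile a w).Nonempty ↔ a ∈ w := by
  constructor
  · rintro ⟨p, hp⟩
    obtain ⟨u, v, rfl, -⟩ := mem_profile.1 hp
    simp
  · intro h
    obtain ⟨u, v, rfl⟩ := List.append_of_mem h
    exact ⟨_, mem_profile.2 ⟨u, v, rfl, rfl⟩⟩

theorem profile_eq_empty {a : A} {w : List A} : profile a w = ∅ ↔ a ∉ w := by
  rw [← Finset.not_nonempty_iff_eq_empty, profile_nonempty]

theorem le_maxBelow_of_mem_profile {a : A} {w : List A} {p : WithBot A} (h : p ∈ profile a w) :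
    p ≤ maxBelow a w := by
  obtain ⟨u, v, rfl, rfl⟩ := mem_profile.1 h
  exact (maxBelow_le_append a (u ++ [a]) v).trans (by simp)

theorem profile_append (a : A) (u v : List A) :
    profile a (u ++ v) = (profile a u).image (fun p => max p (maxBelow a v)) ∪ profile a v := by
  induction u with
  | nil => simp [profile]
  | cons x u ih =>
    by_cases h : x = a <;> simp [profile, h, ih, maxBelow_append, Finset.image_insert]

theorem profile_subset_append (a : A) (u v : List A) : profile a v ⊆ profile a (u ++ v) := by
  rw [profile_append]
  exact Finset.subset_union_right

theorem mem_iff_of_profile_eq {u v : List A} (h : ∀ a, profile a u = profile a v) (x : A) :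
    x ∈ u ↔ x ∈ v := by
  rw [← profile_nonempty, h, profile_nonempty]

theorem profile_swap {a b c : A} {W : List A} (hab : a ≤ b) (hbc : b < c) (hb : b ∈ W) (x : A) :
    profile x (a :: c :: W) = profile x (c :: a :: W) := by
  have hac := hab.trans_lt hbc
  by_cases h1 : a = x
  · subst h1
    simp [profile, maxBelow, hac.ne', hac.not_gt]
  · by_cases h2 : c = x
    · subst h2
      have : (a : WithBot A) ≤ maxBelow c W := (WithBot.coe_le_coe.2 hab).trans (le_maxBelow hb hbc)
      simp [profile, maxBelow, hac.ne, hac, this]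
    · simp [profile, h1, h2]

/-- Having the same profiles, as a congruence. -/
def profileCon (A : Type*) [LinearOrder A] : Con (FreeMonoid A) where
  r u v := ∀ a, profile a u.toList = profile a v.toList
  iseqv := ⟨fun _ _ => rfl, fun h a => (h a).symm, fun h k a => (h a).trans (k a)⟩
  mul' {u u' v v'} h k a := by
    rw [FreeMonoid.toList_mul, FreeMonoid.toList_mul, profile_append, profile_append, h, k,
      maxBelow_congr (mem_iff_of_profile_eq k)]

theorem sylv2Con_le_profileCon : sylv2Con A ≤ profileCon A := by
  refine Con.conGen_le.2 fun U V h => ?_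
  rcases h with ⟨a, b, c, W, hab, hbc, rfl, rfl⟩ | ⟨a, rfl, rfl⟩
  · intro x
    have := profile_swap (W := W.toList ++ [b]) hab hbc (by simp) x
    simpa [FreeMonoid.toList_mul] using this
  · intro x
    by_cases h : a = x <;>
      simp [FreeMonoid.toList_mul, profile, maxBelow, h]

end Profile

section Completeness

variable {A : Type*} [LinearOrder A]

/-- Two lists represent the same element of the 2-sylvester monoid. -/
def Sylv2Equiv (u v : List A) : Prop :=
  sylv2Con A (FreeMonoid.ofList u) (FreeMonoid.ofList v)

namespace Sylv2Equiv

theorem refl (u : List A) : Sylv2Equiv u u := (sylv2Con A).refl _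

theorem symm {u v : List A} (h : Sylv2Equiv u v) : Sylv2Equiv v u := (sylv2Con A).symm h

theorem trans {u v w : List A} (h : Sylv2Equiv u v) (k : Sylv2Equiv v w) : Sylv2Equiv u w :=
  (sylv2Con A).trans h k

theorem append_left {u v : List A} (w : List A) (h : Sylv2Equiv u v) :
    Sylv2Equiv (w ++ u) (w ++ v) :=
  (sylv2Con A).mul ((sylv2Con A).refl (FreeMonoid.ofList w)) h

theorem append_right {u v : List A} (w : List A) (h : Sylv2Equiv u v) :
    Sylv2Equiv (u ++ w) (v ++ w) :=
  (sylv2Con A).mul h ((sylv2Con A).refl (FreeMonoid.ofList w))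

theorem cons {u v : List A} (x : A) (h : Sylv2Equiv u v) : Sylv2Equiv (x :: u) (x :: v) :=
  append_left [x] h

theorem swap {a b c : A} {W : List A} (hab : a ≤ b) (hbc : b < c) (hb : b ∈ W) :
    Sylv2Equiv (a :: c :: W) (c :: a :: W) := by
  obtain ⟨s, t, rfl⟩ := List.append_of_mem hb
  have h : Sylv2Equiv (a :: c :: s ++ [b]) (c :: a :: s ++ [b]) :=
    ConGen.Rel.of _ _ (Or.inl ⟨a, b, c, FreeMonoid.ofList s, hab, hbc, rfl, rfl⟩)
  simpa using h.append_right t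

theorem cons_cons_self (a : A) (W : List A) : Sylv2Equiv (a :: a :: W) (a :: W) :=
  append_right (u := [a, a]) (v := [a]) W (ConGen.Rel.of _ _ (Or.inr ⟨a, rfl, rfl⟩))

/-- A letter whose profile already contains the current maximum can be prepended. -/
theorem cons_of_mem_profile {y : A} {u : List A} (h : maxBelow y u ∈ profile y u) :
    Sylv2Equiv (y :: u) u := by
  induction u with
  | nil => simp [profile] at h
  | cons z u ih =>
    by_cases hz : z = y
    · subst hz
      exact cons_cons_self z u
    · have h' : maxBelow y (z :: u) ∈ profile y u := by simpa [profile, hz] using h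
      have hle := le_maxBelow_of_mem_profile h'
      have heq : maxBelow y (z :: u) = maxBelow y u :=
        le_antisymm hle (maxBelow_le_append y [z] u)
      rw [heq] at h'
      have hy : y ∈ u := profile_nonempty.1 ⟨_, h'⟩
      have key : Sylv2Equiv (y :: z :: u) (z :: y :: u) := by
        rcases lt_or_gt_of_ne hz with hlt | hgt
        · have hzm : (z : WithBot A) ≤ maxBelow y u :=
            (le_maxBelow (List.mem_cons_self) hlt).trans hle
          obtain ⟨b, hb⟩ := WithBot.ne_bot_iff_exists.1
            (ne_bot_of_le_ne_bot WithBot.coe_ne_bot hzm)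
          have hm := mem_of_maxBelow_eq hb.symm
          rw [← hb, WithBot.coe_le_coe] at hzm
          exact (swap hzm hm.2 hm.1).symm
        · exact swap le_rfl hgt hy
      exact key.trans ((ih h').cons z)

/-- A letter commutes with a block `q` when every letter of `q` is separated from it by a later
letter. -/
theorem move {z : A} {q s : List A}
    (hlt : ∀ c ∈ q, c < z → ∃ e ∈ s, c ≤ e ∧ e < z)
    (hgt : ∀ c ∈ q, z < c → ∃ e ∈ s, z ≤ e ∧ e < c) :
    Sylv2Equiv (z :: (q ++ s)) (q ++ z :: s) := by
  induction q with
  | nil => exact refl _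
  | cons c q ih =>
    have ih' := (ih (fun d hd => hlt d (List.mem_cons_of_mem _ hd))
      (fun d hd => hgt d (List.mem_cons_of_mem _ hd))).cons c
    refine trans ?_ ih'
    rcases lt_trichotomy c z with h | rfl | h
    · obtain ⟨e, he, h1, h2⟩ := hlt c List.mem_cons_self h
      exact (swap h1 h2 (List.mem_append_right _ he)).symm
    · exact refl _
    · obtain ⟨e, he, h1, h2⟩ := hgt c List.mem_cons_self h
      exact swap h1 h2 (List.mem_append_right _ he)

end Sylv2Equiv

/-- If after each letter `c > z` of `q` there is a letter in `[z, c)`, and `z` is not in `q`,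
then `s` contains a letter in `[z, c)` for each letter `c > z` of `q`. -/
theorem exists_mem_between {z : A} {q s : List A} (hz : z ∉ q)
    (h : ∀ q₁ c q₂, q = q₁ ++ c :: q₂ → z < c → (z : WithBot A) ≤ maxBelow c (q₂ ++ s)) :
    ∀ c ∈ q, z < c → ∃ e ∈ s, z ≤ e ∧ e < c := by
  induction q with
  | nil => simp
  | cons d q ih =>
    have hq : z ∉ q := fun h' => hz (List.mem_cons_of_mem _ h')
    have ih' := ih hq fun q₁ c q₂ hq' => h (d :: q₁) c q₂ (by simp [hq'])
    intro c hc hzc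
    rcases List.mem_cons.1 hc with rfl | hc
    · have hle := h [] c q rfl hzc
      obtain ⟨b, hb⟩ := WithBot.ne_bot_iff_exists.1 (ne_bot_of_le_ne_bot WithBot.coe_ne_bot hle)
      obtain ⟨hbm, hbc⟩ := mem_of_maxBelow_eq hb.symm
      rw [← hb, WithBot.coe_le_coe] at hle
      rcases List.mem_append.1 hbm with hbq | hbs
      · have hzb : z < b := lt_of_le_of_ne hle fun h' => hq (h' ▸ hbq)
        obtain ⟨e, he, h1, h2⟩ := ih' b hbq hzb
        exact ⟨e, he, h1, h2.trans hbc⟩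
      · exact ⟨b, hbs, hle, hbc⟩
    · exact ih' c hc hzc

/-- Words with a common suffix and the same profiles are equivalent. -/
theorem sylv2Equiv_append_of_profile_eq (n : ℕ) (u v s : List A) (hn : u.length + v.length ≤ n)
    (h : ∀ a, profile a (u ++ s) = profile a (v ++ s)) : Sylv2Equiv (u ++ s) (v ++ s) := by
  induction n generalizing u v s with
  | zero =>
    have hu : u = [] := List.length_eq_zero_iff.1 (by omega)
    have hv : v = [] := List.length_eq_zero_iff.1 (by omega)
    subst hu hv
    exact Sylv2Equiv.refl _
  | succ n ih =>
    have remove (p : List A) (c : A) (q : List A)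
        (hc : maxBelow c (q ++ s) ∈ profile c (q ++ s)) :
        Sylv2Equiv ((p ++ c :: q) ++ s) ((p ++ q) ++ s) := by
      simpa using (Sylv2Equiv.cons_of_mem_profile hc).append_left p
    by_cases hu : ∃ p c q, u = p ++ c :: q ∧ maxBelow c (q ++ s) ∈ profile c (q ++ s)
    · obtain ⟨p, c, q, rfl, hc⟩ := hu
      have e := remove p c q hc
      refine e.trans (ih _ _ _ (by simp at hn ⊢; omega) fun a => ?_)
      exact (sylv2Con_le_profileCon e a).symm.trans (h a)
    rcases List.eq_nil_or_concat v with rfl | ⟨v, z, rfl⟩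
    · rcases List.eq_nil_or_concat u with rfl | ⟨u, x, rfl⟩
      · exact Sylv2Equiv.refl _
      · refine absurd ⟨u, x, [], by simp, ?_⟩ hu
        have := h x
        simp only [List.nil_append] at this ⊢
        rw [← this]
        exact mem_profile.2 ⟨u, s, by simp, rfl⟩
    simp only [List.concat_eq_append] at *
    by_cases hv : maxBelow z s ∈ profile z s
    · have e := remove v z [] hv
      rw [List.append_nil] at e
      refine Sylv2Equiv.trans (ih u v s (by simp at hn; omega) fun a => ?_) e.symm
      exact (h a).trans (sylv2Con_le_profileCon e a)
    have hzm : maxBelow z s ∈ profile z (u ++ s) := by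
      rw [h]
      exact mem_profile.2 ⟨v, s, by simp, rfl⟩
    have hzu : z ∈ u := by
      rw [profile_append, Finset.mem_union, or_iff_left hv] at hzm
      exact profile_nonempty.1 (Finset.image_nonempty.1 ⟨_, hzm⟩)
    obtain ⟨q', p', hqp, hzq'⟩ := List.eq_append_cons_of_mem (List.mem_reverse.2 hzu)
    obtain ⟨p, q, rfl, hzq⟩ : ∃ p q, u = p ++ z :: q ∧ z ∉ q :=
      ⟨p'.reverse, q'.reverse, by simpa using congrArg List.reverse hqp, by simpa using hzq'⟩
    have hqs : maxBelow z (q ++ s) = maxBelow z s := by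
      refine le_antisymm ?_ (maxBelow_le_append _ _ _)
      rw [List.append_assoc, profile_append, Finset.mem_union] at hzm
      rcases hzm with hzm | hzm
      · obtain ⟨r, -, hr⟩ := Finset.mem_image.1 hzm
        rw [← hr]
        exact le_max_of_le_right (by simp [maxBelow])
      · obtain ⟨p₁, t, ht, hr⟩ := mem_profile.1 hzm
        cases p₁ with
        | nil =>
          simp only [List.cons_append, List.nil_append, List.cons.injEq, true_and] at ht
          rw [hr, ht]
        | cons y p₁ =>
          exfalso
          simp only [List.cons_append, List.cons.injEq] at ht
          refine hv ?_
          have : profile z (q ++ s) = profile z s := by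
            rw [profile_append, profile_eq_empty.2 hzq]; simp
          rw [← this]
          exact mem_profile.2 ⟨p₁, t, ht.2, hr⟩
    have hmove : Sylv2Equiv (z :: (q ++ s)) (q ++ z :: s) := by
      refine Sylv2Equiv.move (fun c hc hcz => ?_) (exists_mem_between hzq fun q₁ c q₂ hq hzc => ?_)
      · have hle := le_maxBelow (List.mem_append_left s hc) hcz
        rw [hqs] at hle
        obtain ⟨b, hb⟩ := WithBot.ne_bot_iff_exists.1 (ne_bot_of_le_ne_bot WithBot.coe_ne_bot hle)
        obtain ⟨hbm, hbc⟩ := mem_of_maxBelow_eq hb.symm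
        rw [← hb, WithBot.coe_le_coe] at hle
        exact ⟨b, hbm, hle, hbc⟩
      · subst hq
        have hmem : maxBelow c (q₂ ++ s) ∈ profile c ((v ++ [z]) ++ s) := by
          rw [← h]
          exact mem_profile.2 ⟨p ++ z :: q₁, q₂ ++ s, by simp, rfl⟩
        rw [List.append_assoc, profile_append, Finset.mem_union] at hmem
        rcases hmem with hmem | hmem
        · obtain ⟨r, -, hr⟩ := Finset.mem_image.1 hmem
          rw [← hr]
          exact le_max_of_le_right (le_maxBelow (by simp) hzc)
        · refine absurd ⟨p ++ z :: q₁, c, q₂, by simp, ?_⟩ hu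
          refine profile_subset_append c q₂ s ?_
          simpa [profile, hzc.ne] using hmem
    have e : Sylv2Equiv ((p ++ z :: q) ++ s) ((p ++ q) ++ z :: s) := by
      simpa using hmove.append_left p
    refine e.trans ?_
    rw [List.append_assoc v [z] s, List.singleton_append]
    refine ih _ _ _ (by simp at hn ⊢; omega) fun a => ?_
    have := (sylv2Con_le_profileCon e a).symm.trans (h a)
    simpa using this

theorem sylv2Equiv_iff {u v : List A} : Sylv2Equiv u v ↔ ∀ a, profile a u = profile a v := by
  refine ⟨fun h => sylv2Con_le_profileCon h, fun h => ?_⟩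
  simpa using sylv2Equiv_append_of_profile_eq _ u v [] le_rfl (by simpa using h)

end Completeness

section Counting

/-- The number of ways to extend a full-support idempotent profile with `m` records by `l` further
larger letters. -/
def extensionCount : ℕ → ℕ → ℕ
  | 0, _ => 1
  | l + 1, m => extensionCount l (m + 1) +
      ∑ j ∈ Finset.range m, 2 ^ (m - 1 - j) * extensionCount l (j + 1)

open PowerSeries in
theorem extensionCount_zero_right (k : ℕ) : extensionCount k 0 = shiftedSchroeder k := by
  set D : PowerSeries ℤ := PowerSeries.mk fun n => (schroeder n : ℤ) with hD
  have hDeq : D = 1 + X * (D * (1 + D)) := by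
    ext n
    cases n with
    | zero => simp [hD, schroeder]
    | succ n =>
      rw [mul_add, mul_one, map_add, coeff_succ_X_mul, map_add, coeff_mul,
        Finset.Nat.sum_antidiagonal_eq_sum_range_succ
          (fun i j => coeff i D * coeff j D)]
      simp only [hD, coeff_mk, coeff_one, Nat.succ_ne_zero, if_false, zero_add]
      rw [schroeder, Finset.sum_attach (Finset.range (n + 1))
        (fun k => schroeder k * schroeder (n - k))]
      push_cast
      rfl
  let G : ℕ → PowerSeries ℤ := fun m => 1 + X * (D * (1 + D) ^ m)
  have hG (m : ℕ) : D * (1 + D) ^ m =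
      G (m + 1) + ∑ j ∈ Finset.range m, 2 ^ (m - 1 - j) * G (j + 1) := by
    induction m with
    | zero => simpa [G] using hDeq
    | succ m ih =>
      have hs : ∑ j ∈ Finset.range m, 2 ^ (m + 1 - 1 - j) * G (j + 1) =
          2 * ∑ j ∈ Finset.range m, 2 ^ (m - 1 - j) * G (j + 1) := by
        rw [Finset.mul_sum]
        refine Finset.sum_congr rfl fun j hj => ?_
        rw [← mul_assoc, ← pow_succ']
        congr 2
        have := Finset.mem_range.1 hj
        omega
      rw [Finset.sum_range_succ, hs, eq_sub_of_add_eq' ih.symm]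
      simp only [G, Nat.add_sub_cancel, Nat.sub_self, pow_zero, one_mul]
      linear_combination (D * (1 + D) ^ m) * hDeq
  have hE (l m : ℕ) : (extensionCount l m : ℤ) = coeff l (G m) := by
    induction l generalizing m with
    | zero => simp [extensionCount, G]
    | succ l ih =>
      have h2 (e : ℕ) : (2 : PowerSeries ℤ) ^ e = C (2 ^ e) := by simp
      have : coeff (l + 1) (G m) = coeff l (D * (1 + D) ^ m) := by
        simp [G, coeff_succ_X_mul, coeff_one]
      rw [this, hG, map_add, map_sum, extensionCount]
      simp only [h2, coeff_C_mul, ← ih]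
      push_cast
      rfl
  have h := hE k 0
  cases k with
  | zero => rfl
  | succ k =>
    simp only [G, pow_zero, mul_one, map_add, coeff_one, Nat.succ_ne_zero, if_false, zero_add,
      coeff_succ_X_mul] at h
    simpa [hD, shiftedSchroeder] using h

/-- The binomial transform of `extensionCount`: further letters may also be left out. -/
def partialExtensionCount (l m : ℕ) : ℕ :=
  ∑ k ∈ Finset.range (l + 1), l.choose k * extensionCount k m

theorem partialExtensionCount_succ (l m : ℕ) :
    partialExtensionCount (l + 1) m = partialExtensionCount l m +
      (partialExtensionCount l (m + 1) +
        ∑ j ∈ Finset.range m, 2 ^ (m - 1 - j) * partialExtensionCount l (j + 1)) := by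
  have h1 : partialExtensionCount (l + 1) m = partialExtensionCount l m +
      ∑ k ∈ Finset.range (l + 1), l.choose k * extensionCount (k + 1) m := by
    unfold partialExtensionCount
    rw [Finset.sum_range_succ']
    simp only [Nat.choose_succ_succ, add_mul, Finset.sum_add_distrib]
    rw [Finset.sum_range_succ (fun k => l.choose (k + 1) * extensionCount (k + 1) m),
      Finset.sum_range_succ' (fun k => l.choose k * extensionCount k m) l]
    simp
    ring
  rw [h1]
  congr 1
  simp only [extensionCount, mul_add, Finset.sum_add_distrib, partialExtensionCount,
    Finset.mul_sum]
  congr 1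
  rw [Finset.sum_comm]
  refine Finset.sum_congr rfl fun j _ => Finset.sum_congr rfl fun k _ => ?_
  ring

theorem sum_powerset_insert_top {B M : Type*} [LinearOrder B] [AddCommMonoid M] (t : B)
    (s : Finset B) (hs : ∀ r ∈ s, r < t) (g : ℕ → M) :
    ∑ Q ∈ s.powerset, g ((insert t s).filter fun r => ∀ p ∈ insert t Q, r ≤ p).card =
      g (s.card + 1) + ∑ j ∈ Finset.range s.card, 2 ^ (s.card - 1 - j) • g (j + 1) := by
  induction s using Finset.induction_on_min generalizing g with
  | empty => simp [Finset.filter_singleton]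
  | insert a s ha ih =>
    have has : a ∉ s := fun h => lt_irrefl _ (ha a h)
    have hat : a < t := hs a (Finset.mem_insert_self _ _)
    have hs' : ∀ r ∈ s, r < t := fun r hr => hs r (Finset.mem_insert_of_mem hr)
    rw [Finset.sum_powerset_insert has]
    have e1 : ∀ Q ∈ s.powerset,
        ((insert t (insert a s)).filter fun r => ∀ p ∈ insert t Q, r ≤ p).card =
        ((insert t s).filter fun r => ∀ p ∈ insert t Q, r ≤ p).card + 1 := by
      intro Q hQ
      have hQs := Finset.mem_powerset.1 hQ
      rw [Finset.insert_comm, Finset.filter_insert, if_pos, Finset.card_insert_of_notMem]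
      · simp [hat.ne, has]
      · intro p hp
        rcases Finset.mem_insert.1 hp with rfl | hp
        · exact hat.le
        · exact (ha p (hQs hp)).le
    have e2 : ∀ Q ∈ s.powerset,
        ((insert t (insert a s)).filter fun r => ∀ p ∈ insert t (insert a Q), r ≤ p).card =
        1 := by
      intro Q hQ
      have hQs := Finset.mem_powerset.1 hQ
      rw [Finset.card_eq_one]
      refine ⟨a, ?_⟩
      ext r
      simp only [Finset.mem_filter, Finset.mem_insert, Finset.mem_singleton]
      constructor
      · rintro ⟨rfl | rfl | hr, h⟩
        · exact absurd (h a (by simp)) hat.not_ge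
        · rfl
        · exact absurd (h a (by simp)) (ha r hr).not_ge
      · rintro rfl
        refine ⟨by simp, ?_⟩
        rintro p (rfl | rfl | hp)
        · exact hat.le
        · exact le_rfl
        · exact (ha p (hQs hp)).le
    rw [Finset.sum_congr rfl fun Q hQ => congrArg g (e1 Q hQ),
      Finset.sum_congr rfl fun Q hQ => congrArg g (e2 Q hQ), ih hs' (fun n => g (n + 1)),
      Finset.card_insert_of_notMem has, Finset.sum_range_succ']
    simp only [Finset.sum_const, Finset.card_powerset, add_assoc, Nat.add_sub_cancel, Nat.sub_zero,
      zero_add]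
    congr 2
    refine Finset.sum_congr rfl fun j hj => ?_
    congr 2
    omega

end Counting

section Extension

variable {A : Type*} [LinearOrder A]

theorem maxBelow_filter_ne {a b : A} (hb : b ≤ a) (w : List A) :
    maxBelow b (w.filter (· ≠ a)) = maxBelow b w := by
  refine le_antisymm (maxBelow_le_iff.2 fun x hx => le_maxBelow (List.mem_of_mem_filter hx))
    (maxBelow_le_iff.2 fun x hx hxb => le_maxBelow ?_ hxb)
  exact List.mem_filter.2 ⟨hx, by simpa using (hxb.trans_le hb).ne⟩

theorem profile_filter_ne {a b : A} (hb : b < a) (w : List A) :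
    profile b (w.filter (· ≠ a)) = profile b w := by
  induction w with
  | nil => rfl
  | cons x w ih =>
    have := maxBelow_filter_ne hb.le w
    by_cases hx : x = a
    · simp [hx, profile, hb.ne', ← ih]
    · by_cases hxb : x = b
      · subst hxb
        rw [List.filter_cons_of_pos (by simpa using hx)]
        simp only [profile, if_true, ih, this]
      · rw [List.filter_cons_of_pos (by simpa using hx)]
        simp only [profile, hxb, if_false, ih]

/-- The words all of whose letters realise the largest value in their profile; these represent
the idempotents. -/
def IsIdemWord (w : List A) : Prop :=
  ∀ a ∈ w, maxBelow a w ∈ profile a w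

theorem isIdemWord_iff {w : List A} : IsIdemWord w ↔ Sylv2Equiv (w ++ w) w := by
  rw [sylv2Equiv_iff]
  refine forall_congr' fun a => ?_
  rw [profile_append, Finset.union_eq_right]
  have him : ∀ p ∈ profile a w, max p (maxBelow a w) = maxBelow a w := fun p hp =>
    max_eq_right (le_maxBelow_of_mem_profile hp)
  constructor
  · intro h q hq
    obtain ⟨p, hp, rfl⟩ := Finset.mem_image.1 hq
    rw [him p hp]
    exact h (profile_nonempty.1 ⟨p, hp⟩)
  · intro h ha
    obtain ⟨p, hp⟩ := profile_nonempty.2 ha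
    exact h (Finset.mem_image.2 ⟨p, hp, him p hp⟩)

/-- The profile functions of idempotent words with letters in `s`. -/
def idemProfiles (s : Finset A) : Set (A → Finset (WithBot A)) :=
  {f | ∃ w : List A, (∀ x ∈ w, x ∈ s) ∧ IsIdemWord w ∧ (fun a => profile a w) = f}

theorem idemProfiles_apply_eq_empty {s : Finset A} {f : A → Finset (WithBot A)}
    (hf : f ∈ idemProfiles s) {b : A} (hb : b ∉ s) : f b = ∅ := by
  obtain ⟨w, hw, -, rfl⟩ := hf
  exact profile_eq_empty.2 fun h => hb (hw b h)

theorem idemProfiles_empty : idemProfiles (∅ : Finset A) = {fun _ => ∅} := by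
  ext f
  constructor
  · intro hf
    exact funext fun b => idemProfiles_apply_eq_empty hf (Finset.notMem_empty b)
  · rintro rfl
    exact ⟨[], by simp, by simp [IsIdemWord], rfl⟩

variable [Fintype A]

open scoped Classical in
/-- The right-to-left records of a word with profile `f`, together with `⊥`: the possible values
in the profile of a further letter that is larger than all letters of the word. -/
noncomputable def records (f : A → Finset (WithBot A)) : Finset (WithBot A) :=
  Finset.univ.filter fun p => ∀ r : A, p = r → (f r).Nonempty ∧ ∀ c, r < c → ∀ q ∈ f c, p ≤ q

theorem mem_records {f : A → Finset (WithBot A)} {p : WithBot A} :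
    p ∈ records f ↔ ∀ r : A, p = r → (f r).Nonempty ∧ ∀ c, r < c → ∀ q ∈ f c, p ≤ q := by
  simp [records]

theorem bot_mem_records (f : A → Finset (WithBot A)) : ⊥ ∈ records f :=
  mem_records.2 fun _ h => absurd h WithBot.bot_ne_coe

theorem records_const_empty : records (fun _ : A => ∅) = {⊥} := by
  ext p
  rw [mem_records, Finset.mem_singleton]
  induction p <;> simp

/-- The possible profiles of a new largest letter in an extension of `f`. -/
noncomputable def choices (f : A → Finset (WithBot A)) : Finset (Finset (WithBot A)) :=
  insert ∅ (((records f).erase ((records f).sup id)).powerset.image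
    (insert ((records f).sup id)))

theorem sup_records_mem (f : A → Finset (WithBot A)) : (records f).sup id ∈ records f := by
  obtain ⟨p, hp, h⟩ := Finset.exists_mem_eq_sup (records f) ⟨_, bot_mem_records f⟩ id
  rw [h]
  exact hp

theorem mem_choices {f : A → Finset (WithBot A)} {Q : Finset (WithBot A)} :
    Q ∈ choices f ↔ Q ⊆ records f ∧ (Q.Nonempty → (records f).sup id ∈ Q) := by
  simp only [choices, Finset.mem_insert, Finset.mem_image, Finset.mem_powerset]
  constructor
  · rintro (rfl | ⟨R, hR, rfl⟩)
    · simp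
    · refine ⟨Finset.insert_subset (sup_records_mem f) (hR.trans (Finset.erase_subset _ _)), ?_⟩
      simp
  · rintro ⟨h1, h2⟩
    rcases Q.eq_empty_or_nonempty with h | h
    · exact Or.inl h
    · exact Or.inr ⟨Q.erase _, Finset.erase_subset_erase _ h1, Finset.insert_erase (h2 h)⟩

theorem sup_records_profile {a : A} {w : List A} (hw : ∀ x ∈ w, x < a) :
    (records fun b => profile b w).sup id = maxBelow a w := by
  refine le_antisymm (Finset.sup_le fun p hp => ?_) (Finset.le_sup (f := id) ?_)
  · induction p with
    | bot => exact bot_le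
    | coe r =>
      have := profile_nonempty.1 (mem_records.1 hp r rfl).1
      exact le_maxBelow this (hw r this)
  · refine mem_records.2 fun r hr => ?_
    have hm := mem_of_maxBelow_eq hr
    refine ⟨profile_nonempty.2 hm.1, fun c hc q hq => absurd hc ?_⟩
    have hcw := profile_nonempty.1 ⟨q, hq⟩
    have := le_maxBelow hcw (hw c hcw)
    rw [hr, WithBot.coe_le_coe] at this
    exact this.not_gt

theorem exists_append_of_mem_records {a : A} {w : List A} (hw : ∀ x ∈ w, x < a) {p : WithBot A}
    (hp : p ∈ records fun b => profile b w) : ∃ u v, w = u ++ v ∧ maxBelow a v = p := by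
  induction p with
  | bot => exact ⟨w, [], by simp, rfl⟩
  | coe r =>
    obtain ⟨hr, h⟩ := mem_records.1 hp r rfl
    have hrw := profile_nonempty.1 hr
    obtain ⟨q', p', hqp, hq'⟩ := List.eq_append_cons_of_mem (List.mem_reverse.2 hrw)
    obtain ⟨p, q, rfl, hq⟩ : ∃ p q, w = p ++ r :: q ∧ r ∉ q :=
      ⟨p'.reverse, q'.reverse, by simpa using congrArg List.reverse hqp, by simpa using hq'⟩
    refine ⟨p, r :: q, rfl, le_antisymm (maxBelow_le_iff.2 fun x hx hxa => ?_)
      (le_maxBelow List.mem_cons_self (hw r hrw))⟩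
    rcases List.mem_cons.1 hx with rfl | hx
    · exact le_rfl
    · refine WithBot.coe_le_coe.2 (not_lt.1 fun hlt => ?_)
      obtain ⟨e, he, -⟩ := exists_mem_between (s := []) hq (fun q₁ c q₂ hq hc => by
        refine h c hc _ (mem_profile.2 ⟨p ++ r :: q₁, q₂, by simp [hq], by simp⟩)) x hx hlt
      simp at he

/-- Copies of a new largest letter can be inserted at any set of records. -/
theorem exists_insert_letter {a : A} {w : List A} (hw : ∀ x ∈ w, x < a)
    {Q : Finset (WithBot A)} (hQ : Q ⊆ records fun b => profile b w) :
    ∃ w' : List A, w'.filter (· ≠ a) = w ∧ profile a w' = Q := by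
  induction Q using Finset.induction_on with
  | empty =>
    have ha : a ∉ w := fun h => lt_irrefl _ (hw a h)
    refine ⟨w, List.filter_eq_self.2 fun x hx => ?_, profile_eq_empty.2 ha⟩
    simpa using (hw x hx).ne
  | insert p Q hp ih =>
    obtain ⟨hpr, hQ⟩ := Finset.insert_subset_iff.1 hQ
    obtain ⟨w', hw', rfl⟩ := ih hQ
    obtain ⟨u, v, huv, hv⟩ := exists_append_of_mem_records hw hpr
    rw [huv] at hw'
    obtain ⟨u', v', rfl, rfl, rfl⟩ := List.filter_eq_append_iff.1 hw'
    rw [maxBelow_filter_ne le_rfl] at hv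
    refine ⟨u' ++ a :: v', by simp [huv], ?_⟩
    rw [profile_append, profile_append]
    simp [profile, maxBelow, hv]

theorem profile_mem_choices {a : A} {w : List A} (hw : ∀ x ∈ w, x ≤ a) (hidem : IsIdemWord w) :
    profile a w ∈ choices fun b => profile b (w.filter (· ≠ a)) := by
  have hlt : ∀ x ∈ w.filter (· ≠ a), x < a := fun x hx => by
    have := List.mem_filter.1 hx
    exact lt_of_le_of_ne (hw x this.1) (by simpa using this.2)
  refine mem_choices.2 ⟨fun p hp => mem_records.2 fun r hr => ?_, fun h => ?_⟩
  · obtain ⟨u, v, rfl, rfl⟩ := mem_profile.1 hp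
    have hm := mem_of_maxBelow_eq hr
    refine ⟨profile_nonempty.2 (List.mem_filter.2 ⟨by simp [hm.1], by simpa using hm.2.ne⟩),
      fun c hc q hq => ?_⟩
    have hca := hlt c (profile_nonempty.1 ⟨q, hq⟩)
    rw [profile_filter_ne hca] at hq
    obtain ⟨u₂, v₂, h, rfl⟩ := mem_profile.1 hq
    rcases List.append_eq_append_iff.1 h with ⟨t, rfl, ht⟩ | ⟨t, rfl, ht⟩
    · cases t with
      | nil =>
        simp only [List.nil_append, List.cons.injEq] at ht
        exact absurd ht.1 hca.ne'
      | cons y t =>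
        simp only [List.cons_append, List.cons.injEq] at ht
        have := le_maxBelow (v := v) (a := a) (x := c) (by simp [ht.2]) hca
        rw [hr, WithBot.coe_le_coe] at this
        exact absurd hc this.not_gt
    · cases t with
      | nil =>
        simp only [List.nil_append, List.cons.injEq] at ht
        exact absurd ht.1 hca.ne
      | cons y t =>
        simp only [List.cons_append, List.cons.injEq] at ht
        rw [hr]
        exact le_maxBelow (by simp [ht.2, hm.1]) hc
  · rw [sup_records_profile hlt, maxBelow_filter_ne le_rfl]
    exact hidem a (profile_nonempty.1 h)

theorem mem_idemProfiles_insert {a : A} {s : Finset A} (hs : ∀ x ∈ s, x < a)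
    {f : A → Finset (WithBot A)} :
    f ∈ idemProfiles (insert a s) ↔
      ∃ f₀ ∈ idemProfiles s, ∃ Q ∈ choices f₀, Function.update f₀ a Q = f := by
  have hupd (w : List A) (hw : ∀ x ∈ w, x ≤ a) :
      Function.update (fun b => profile b (w.filter (· ≠ a))) a (profile a w) =
        fun b => profile b w := by
    funext b
    rcases eq_or_ne b a with rfl | hb
    · simp
    rw [Function.update_of_ne hb]
    rcases lt_or_gt_of_ne hb with h | h
    · exact profile_filter_ne h w
    · have hbw : b ∉ w := fun hbw => (hw b hbw).not_gt h
      rw [profile_eq_empty.2 hbw, profile_eq_empty.2 fun h' => hbw (List.mem_of_mem_filter h')]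
  constructor
  · rintro ⟨w, hw, hidem, rfl⟩
    have hwa : ∀ x ∈ w, x ≤ a := fun x hx => by
      rcases Finset.mem_insert.1 (hw x hx) with rfl | h
      exacts [le_rfl, (hs x h).le]
    have hfs : ∀ x ∈ w.filter (· ≠ a), x ∈ s := fun x hx => by
      have := List.mem_filter.1 hx
      exact (Finset.mem_insert.1 (hw x this.1)).resolve_left (by simpa using this.2)
    refine ⟨_, ⟨w.filter (· ≠ a), hfs, fun b hb => ?_, rfl⟩, profile a w,
      profile_mem_choices hwa hidem, hupd w hwa⟩
    have hba := hs b (hfs b hb)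
    rw [maxBelow_filter_ne hba.le, profile_filter_ne hba]
    exact hidem b (List.mem_of_mem_filter hb)
  · rintro ⟨_, ⟨w, hw, hidem, rfl⟩, Q, hQ, rfl⟩
    have hlt : ∀ x ∈ w, x < a := fun x hx => hs x (hw x hx)
    obtain ⟨hQ1, hQ2⟩ := mem_choices.1 hQ
    obtain ⟨w', rfl, rfl⟩ := exists_insert_letter hlt hQ1
    rw [sup_records_profile hlt, maxBelow_filter_ne le_rfl] at hQ2
    have hw's : ∀ x ∈ w', x ∈ insert a s := fun x hx => by
      by_cases hxa : x = a
      · simp [hxa]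
      · exact Finset.mem_insert_of_mem (hw x (List.mem_filter.2 ⟨hx, by simpa using hxa⟩))
    have hw'a : ∀ x ∈ w', x ≤ a := fun x hx => by
      rcases Finset.mem_insert.1 (hw's x hx) with rfl | h
      exacts [le_rfl, (hs x h).le]
    refine ⟨w', hw's, fun b hb => ?_, (hupd w' hw'a).symm⟩
    rcases (hw'a b hb).eq_or_lt with rfl | hba
    · exact hQ2 (profile_nonempty.2 hb)
    · have := hidem b (List.mem_filter.2 ⟨hb, by simpa using hba.ne⟩)
      rwa [maxBelow_filter_ne hba.le, profile_filter_ne hba] at this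

theorem records_update {a : A} {f : A → Finset (WithBot A)} (hf : ∀ b, a ≤ b → f b = ∅)
    {Q : Finset (WithBot A)} (hQ : Q.Nonempty) :
    records (Function.update f a Q) =
      insert (a : WithBot A) ((records f).filter fun p => ∀ q ∈ Q, p ≤ q) := by
  ext p
  rw [Finset.mem_insert, Finset.mem_filter, mem_records, mem_records]
  induction p with
  | bot => simp
  | coe r =>
    simp only [WithBot.coe_inj, forall_eq']
    rcases lt_trichotomy r a with h | rfl | h
    · rw [Function.update_of_ne h.ne]
      constructor
      · rintro ⟨h1, h2⟩
        refine Or.inr ⟨⟨h1, fun c hc q hq => h2 c hc q ?_⟩, fun q hq => h2 a h q (by simpa using hq)⟩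
        rcases eq_or_ne c a with rfl | hca
        · simp [hf c le_rfl] at hq
        · rwa [Function.update_of_ne hca]
      · rintro (h1 | ⟨⟨h1, h2⟩, h3⟩)
        · exact absurd h1 h.ne
        · refine ⟨h1, fun c hc q hq => ?_⟩
          rcases eq_or_ne c a with rfl | hca
          · exact h3 q (by simpa using hq)
          · exact h2 c hc q (by rwa [Function.update_of_ne hca] at hq)
    · simp only [Function.update_self, hQ, true_and, true_or, iff_true]
      intro c hc q hq
      rw [Function.update_of_ne hc.ne', hf c hc.le] at hq
      simp at hq
    · simp [hf r h.le, h.ne']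

theorem sum_choices {a : A} {f : A → Finset (WithBot A)} (hf : ∀ b, a ≤ b → f b = ∅) (l : ℕ) :
    ∑ Q ∈ choices f, partialExtensionCount l ((records (Function.update f a Q)).card - 1) =
      partialExtensionCount (l + 1) ((records f).card - 1) := by
  set t := (records f).sup id with ht
  set M := (records f).erase t with hM
  have htM : insert t M = records f := Finset.insert_erase (sup_records_mem f)
  have hlt : ∀ r ∈ M, r < t := fun r hr =>
    lt_of_le_of_ne (Finset.le_sup (f := id) (Finset.mem_of_mem_erase hr))
      (Finset.ne_of_mem_erase hr)
  have hcard : (records f).card - 1 = M.card :=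
    (Finset.card_erase_of_mem (sup_records_mem f)).symm
  have hch : choices f = insert ∅ (M.powerset.image (insert t)) := by
    simp only [choices, ← ht, ← hM]
  have hinj : Set.InjOn (insert t) (M.powerset : Set (Finset (WithBot A))) := by
    intro Q hQ R hR h
    have hnot : ∀ S ∈ (M.powerset : Set (Finset (WithBot A))), t ∉ S := fun S hS h' =>
      lt_irrefl _ (hlt t (Finset.mem_powerset.1 hS h'))
    rw [← Finset.erase_insert (hnot Q hQ), h, Finset.erase_insert (hnot R hR)]
  have hempty : Function.update f a ∅ = f := by
    rw [← hf a le_rfl, Function.update_eq_self]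
  have hcount (Q : Finset (WithBot A)) :
      (records (Function.update f a (insert t Q))).card - 1 =
        ((insert t M).filter fun r => ∀ p ∈ insert t Q, r ≤ p).card := by
    rw [records_update hf (Finset.insert_nonempty _ _), Finset.card_insert_of_notMem, htM,
      Nat.add_sub_cancel]
    intro h
    have := (mem_records.1 (Finset.mem_filter.1 h).1 a rfl).1
    simp [hf a le_rfl] at this
  rw [hch, Finset.sum_insert (by simp), Finset.sum_image hinj, hempty, hcard,
    partialExtensionCount_succ]
  simp only [hcount]
  congr 1
  simp only [← smul_eq_mul]
  convert sum_powerset_insert_top t M hlt (partialExtensionCount l)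

theorem sum_idemProfiles (s : Finset A) (l : ℕ) :
    ∑ f ∈ (Set.toFinite (idemProfiles s)).toFinset,
      partialExtensionCount l ((records f).card - 1) = partialExtensionCount (l + s.card) 0 := by
  classical
  induction s using Finset.induction_on_max generalizing l with
  | empty =>
    have : (Set.toFinite (idemProfiles (∅ : Finset A))).toFinset = {fun _ => ∅} := by
      ext f
      simp [idemProfiles_empty]
    rw [this]
    simp [records_const_empty]
  | insert a s hs ih =>
    have has : a ∉ s := fun h => lt_irrefl _ (hs a h)
    have hf : ∀ f ∈ (Set.toFinite (idemProfiles s)).toFinset, ∀ b, a ≤ b → f b = ∅ :=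
      fun f hf b hb => idemProfiles_apply_eq_empty ((Set.Finite.mem_toFinset _).1 hf)
        fun h => (hs b h).not_ge hb
    have himage : (Set.toFinite (idemProfiles (insert a s))).toFinset =
        ((Set.toFinite (idemProfiles s)).toFinset.sigma choices).image
          fun x => Function.update x.1 a x.2 := by
      ext f
      simp only [Set.Finite.mem_toFinset, mem_idemProfiles_insert hs, Finset.mem_image,
        Finset.mem_sigma, Sigma.exists]
      constructor
      · rintro ⟨f₀, h₀, Q, hQ, h⟩
        exact ⟨f₀, Q, ⟨h₀, hQ⟩, h⟩
      · rintro ⟨f₀, Q, ⟨h₀, hQ⟩, h⟩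
        exact ⟨f₀, h₀, Q, hQ, h⟩
    rw [himage, Finset.sum_image, Finset.sum_sigma,
      Finset.sum_congr rfl fun f h => sum_choices (hf f h) l, ih,
      Finset.card_insert_of_notMem has, add_assoc, add_comm 1]
    rintro ⟨f, Q⟩ hfQ ⟨f', Q'⟩ hfQ' h
    simp only [Finset.coe_sigma, Set.mem_sigma_iff, Finset.mem_coe] at hfQ hfQ' h
    have hQ : Q = Q' := by simpa using congrFun h a
    have hff : f = f' := by
      funext b
      rcases eq_or_ne b a with rfl | hb
      · rw [hf f hfQ.1 b le_rfl, hf f' hfQ'.1 b le_rfl]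
      · simpa [Function.update_of_ne hb] using congrFun h b
    rw [hQ, hff]

theorem ncard_idemProfiles_univ :
    (idemProfiles (Finset.univ : Finset A)).ncard = partialExtensionCount (Fintype.card A) 0 := by
  have h := sum_idemProfiles (Finset.univ : Finset A) 0
  simp only [partialExtensionCount, zero_add, Finset.range_one, Finset.sum_singleton,
    Nat.choose_self, extensionCount, mul_one, Finset.sum_const, smul_eq_mul] at h
  rw [Set.ncard_eq_toFinset_card _ (Set.toFinite _), h, Finset.card_univ]
  rfl

end Extension

/-- The profile function of an element of the 2-sylvester monoid. -/
def sylv2Profile {A : Type*} [LinearOrder A] (x : (sylv2Con A).Quotient) :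
    A → Finset (WithBot A) :=
  Con.liftOn x (fun w a => profile a w.toList) fun _ _ h => funext (sylv2Con_le_profileCon h)

theorem sylv2Profile_injective {A : Type*} [LinearOrder A] :
    Function.Injective (sylv2Profile (A := A)) := by
  intro x y
  induction x using Con.induction_on with | H u => ?_
  induction y using Con.induction_on with | H v => ?_
  intro h
  exact (Con.eq _).2 (sylv2Equiv_iff (u := u.toList) (v := v.toList).2 (congrFun h))

theorem image_sylv2Profile {A : Type*} [LinearOrder A] [Fintype A] :
    sylv2Profile '' {x : (sylv2Con A).Quotient | x * x = x} = idemProfiles Finset.univ := by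
  ext f
  constructor
  · rintro ⟨x, hx, rfl⟩
    induction x using Con.induction_on with | H u => ?_
    exact ⟨u.toList, by simp, isIdemWord_iff.2 ((Con.eq _).1 hx), rfl⟩
  · rintro ⟨w, -, hw, rfl⟩
    exact ⟨((FreeMonoid.ofList w : FreeMonoid A) : (sylv2Con A).Quotient),
      (Con.eq _).2 (isIdemWord_iff.1 hw), rfl⟩

/-- The 2-sylvester monoid `Sylv(A, 2)` over an alphabet of size `n` contains exactly
`Σ_{k=0}^{n} binomial(n,k)·S(k)` idempotents, where `S` is the shifted Schröder
sequence. -/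
theorem card_idempotents_sylv2 {A : Type*} [LinearOrder A] [Fintype A] :
    Nat.card {x : (sylv2Con A).Quotient // x * x = x} =
      ∑ k ∈ Finset.range (Fintype.card A + 1),
        Nat.choose (Fintype.card A) k * shiftedSchroeder k := by
  change Nat.card {x : (sylv2Con A).Quotient | x * x = x} = _
  rw [Nat.card_coe_set_eq, ← Set.ncard_image_of_injective _ sylv2Profile_injective,
    image_sylv2Profile, ncard_idemProfiles_univ, partialExtensionCount]
  simp only [extensionCount_zero_right]
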